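/- arXiv:1705.00989 — 3 statements merged into one kernel-verified Lean document; each statement's English description precedes it below -/
import Mathlib

section
/- Let k ≥ 1, let U ⊆ ℝ^d be an open convex set, and let G : U → ℝ^d be a C^k map such that sup_{x ∈ U} ‖I_d − d_x G‖_op ≤ ε for some ε < 1. Then G is injective, G is a C^k-diffeomorphism onto its image G(U), and for every y ∈ G(U), ‖I_d − d_y (G^{-1})‖_op ≤ ε/(1 − ε). -/
open Filter

variable {E : Type*} [NormedAddCommGroup E] [NormedSpace ℝ E]

/-- A map whose differential stays within `ε < 1` of the identity on a convex open set is
injective there. -/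
theorem injOn_of_norm_id_sub_fderiv_le {U : Set E} (hU : IsOpen U) (hconv : Convex ℝ U)
    {G : E → E} (hG : DifferentiableOn ℝ G U) {ε : ℝ} (hε : ε < 1)
    (hder : ∀ x ∈ U, ‖ContinuousLinearMap.id ℝ E - fderiv ℝ G x‖ ≤ ε) : Set.InjOn G U := by
  intro x hx y hy hxy
  have h := hconv.norm_image_sub_le_of_norm_fderiv_le' (φ := ContinuousLinearMap.id ℝ E)
    (fun z hz => hG.differentiableAt (hU.mem_nhds hz))
    (fun z hz => by rw [norm_sub_rev]; exact hder z hz) hx hy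
  rw [hxy, sub_self, zero_sub, norm_neg, ContinuousLinearMap.id_apply] at h
  have h0 : ‖y - x‖ = 0 := by nlinarith [norm_nonneg (y - x)]
  exact (sub_eq_zero.mp (norm_eq_zero.mp h0)).symm

/-- An operator at distance less than `1` from the identity is a continuous linear equivalence. -/
theorem exists_continuousLinearEquiv_of_norm_id_sub_lt_one [CompleteSpace E] {A : E →L[ℝ] E}
    (hA : ‖ContinuousLinearMap.id ℝ E - A‖ < 1) : ∃ e : E ≃L[ℝ] E, (e : E →L[ℝ] E) = A := by
  refine ⟨ContinuousLinearEquiv.ofUnit (Units.oneSub (ContinuousLinearMap.id ℝ E - A) hA), ?_⟩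
  ext x
  change (1 - (ContinuousLinearMap.id ℝ E - A)) x = A x
  simp

/-- Quantitative stability of inversion near the identity. -/
theorem norm_id_sub_symm_le {e : E ≃L[ℝ] E} {ε : ℝ} (hε : ε < 1)
    (he : ‖ContinuousLinearMap.id ℝ E - e‖ ≤ ε) :
    ‖ContinuousLinearMap.id ℝ E - e.symm‖ ≤ ε / (1 - ε) := by
  set I := ContinuousLinearMap.id ℝ E
  have key : I - e.symm = (I - (e.symm : E →L[ℝ] E)).comp (I - (e : E →L[ℝ] E))
      - (I - (e : E →L[ℝ] E)) := by
    ext x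
    simp [I]
    abel
  have h : ‖I - e.symm‖ ≤ ‖I - (e.symm : E →L[ℝ] E)‖ * ε + ε := by
    conv_lhs => rw [key]
    refine (norm_sub_le _ _).trans (add_le_add ?_ he)
    exact (ContinuousLinearMap.opNorm_comp_le _ _).trans (by gcongr)
  rw [le_div_iff₀ (by linarith)]
  linarith

/-- If `G : U → ℝ^d` is `C^k` (`k ≥ 1`) on an open convex set `U` with
`‖I_d − d_x G‖_op ≤ ε < 1` on `U`, then `G` is injective on `U`, it is a `C^k`-diffeomorphism
onto its (open) image, and the differential of the inverse satisfies
`‖I_d − d_y (G⁻¹)‖_op ≤ ε / (1 − ε)` on `G(U)`. -/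
theorem inverse_quantitative_first_order
    (d k : ℕ) (hk : 1 ≤ k)
    (U : Set (EuclideanSpace ℝ (Fin d))) (hU : IsOpen U) (hconv : Convex ℝ U)
    (G : EuclideanSpace ℝ (Fin d) → EuclideanSpace ℝ (Fin d))
    (hG : ContDiffOn ℝ k G U)
    (ε : ℝ) (hε : ε < 1)
    (hder : ∀ x ∈ U,
      ‖ContinuousLinearMap.id ℝ (EuclideanSpace ℝ (Fin d)) - fderiv ℝ G x‖ ≤ ε) :
    Set.InjOn G U ∧ IsOpen (G '' U) ∧
      ∃ H : EuclideanSpace ℝ (Fin d) → EuclideanSpace ℝ (Fin d),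
        ContDiffOn ℝ k H (G '' U) ∧
        (∀ x ∈ U, H (G x) = x) ∧ (∀ y ∈ G '' U, G (H y) = y) ∧
        ∀ y ∈ G '' U,
          ‖ContinuousLinearMap.id ℝ (EuclideanSpace ℝ (Fin d)) - fderiv ℝ H y‖ ≤
            ε / (1 - ε) := by
  have hk0 : (k : WithTop ℕ∞) ≠ 0 := by exact_mod_cast Nat.one_le_iff_ne_zero.mp hk
  have hinj := injOn_of_norm_id_sub_fderiv_le hU hconv (hG.differentiableOn hk0) hε hder
  have hleft : Set.LeftInvOn (Function.invFunOn G U) G U := hinj.leftInvOn_invFunOn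
  have hcd : ∀ x ∈ U, ContDiffAt ℝ k G x := fun x hx => hG.contDiffAt (hU.mem_nhds hx)
  have hequiv : ∀ x ∈ U, ∃ e : EuclideanSpace ℝ (Fin d) ≃L[ℝ] EuclideanSpace ℝ (Fin d),
      (e : EuclideanSpace ℝ (Fin d) →L[ℝ] EuclideanSpace ℝ (Fin d)) = fderiv ℝ G x :=
    fun x hx => exists_continuousLinearEquiv_of_norm_id_sub_lt_one ((hder x hx).trans_lt hε)
  have hstrict : ∀ x ∈ U, HasStrictFDerivAt G (fderiv ℝ G x) x :=
    fun x hx => (hcd x hx).hasStrictFDerivAt hk0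
  refine ⟨hinj, ?_, Function.invFunOn G U, ?_, hleft, ?_, ?_⟩
  · rw [isOpen_iff_mem_nhds]
    rintro _ ⟨x, hx, rfl⟩
    obtain ⟨e, he⟩ := hequiv x hx
    have h := hstrict x hx
    rw [← he] at h
    rw [← h.map_nhds_eq_of_equiv]
    exact image_mem_map (hU.mem_nhds hx)
  · rintro _ ⟨x, hx, rfl⟩
    obtain ⟨e, he⟩ := hequiv x hx
    have h := hstrict x hx
    rw [← he] at h
    have h' : HasFDerivAt G (e : EuclideanSpace ℝ (Fin d) →L[ℝ] EuclideanSpace ℝ (Fin d)) x :=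
      h.hasFDerivAt
    have hloc := (hcd x hx).to_localInverse h' hk0
    refine (hloc.congr_of_eventuallyEq ?_).contDiffWithinAt
    exact HasStrictFDerivAt.localInverse_unique _ (eventually_of_mem (hU.mem_nhds hx) hleft)
  · rintro _ ⟨x, hx, rfl⟩
    rw [hleft hx]
  · rintro _ ⟨x, hx, rfl⟩
    obtain ⟨e, he⟩ := hequiv x hx
    have h := hstrict x hx
    rw [← he] at h
    rw [(h.to_local_left_inverse (eventually_of_mem (hU.mem_nhds hx) hleft)).hasFDerivAt.fderiv]
    exact norm_id_sub_symm_le hε (he ▸ hder x hx)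
end

section
/- Let k ≥ 2, let U ⊆ ℝ^d be an open convex set, and let G : U → ℝ^d be a C^k map such that sup_{x ∈ U} ‖I_d − d_x G‖_op ≤ ε for some ε < 1 and sup_{x ∈ U} ‖d^i_x G‖_op ≤ L_i for all 2 ≤ i ≤ k, where L_2, …, L_k > 0. Then G is a C^k-diffeomorphism onto its image and, for each 2 ≤ i ≤ k, there exists a finite constant L'_{i, ε, L_2, …, L_i}, depending only on i, ε and L_2, …, L_i, such that sup_{y ∈ G(U)} ‖d^i_y (G^{-1})‖_op ≤ L'_{i, ε, L_2, …, L_i}. -/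
open Set Filter
open scoped NNReal Nat ContDiff

section InverseBounds

variable {E : Type*} [NormedAddCommGroup E] [NormedSpace ℝ E]

/-- On a convex open set, a map whose derivative stays within `ε` of the identity is
approximated by the identity with constant `ε`. -/
theorem approximatesLinearOn_refl_of_norm_id_sub_fderiv_le {U : Set E} {G : E → E} {ε : ℝ}
    (hU : IsOpen U) (hconv : Convex ℝ U) (hG : DifferentiableOn ℝ G U)
    (hε : ∀ x ∈ U, ‖ContinuousLinearMap.id ℝ E - fderiv ℝ G x‖ ≤ ε) :
    ApproximatesLinearOn G (ContinuousLinearEquiv.refl ℝ E : E →L[ℝ] E) U ε.toNNReal := by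
  intro x hx y hy
  refine hconv.norm_image_sub_le_of_norm_hasFDerivWithin_le' (f' := fderiv ℝ G)
    (fun z hz => ((hG z hz).differentiableAt (hU.mem_nhds hz)).hasFDerivAt.hasFDerivWithinAt)
    (fun z hz => ?_) hy hx
  rw [norm_sub_rev]
  exact (hε z hz).trans (Real.le_coe_toNNReal ε)

/-- A `C^k` map on a convex open set whose derivative stays within `ε < 1` of the identity is
injective and open, with a `C^k` inverse. -/
theorem exists_contDiffOn_inverse_of_norm_id_sub_fderiv_le [CompleteSpace E] {U : Set E}
    {G : E → E} {ε : ℝ} {k : ℕ} (hk : k ≠ 0) (hε1 : ε < 1)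
    (hU : IsOpen U) (hconv : Convex ℝ U) (hG : ContDiffOn ℝ k G U)
    (hε : ∀ x ∈ U, ‖ContinuousLinearMap.id ℝ E - fderiv ℝ G x‖ ≤ ε) :
    InjOn G U ∧ IsOpen (G '' U) ∧ ∃ H : E → E, ContDiffOn ℝ k H (G '' U) ∧
      (∀ x ∈ U, H (G x) = x) ∧ ∀ y ∈ G '' U, G (H y) = y := by
  have hk' : (k : ℕ∞ω) ≠ 0 := by exact_mod_cast hk
  have happ := approximatesLinearOn_refl_of_norm_id_sub_fderiv_le hU hconv
    (hG.differentiableOn hk') hε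
  have hc : Subsingleton E ∨ ε.toNNReal <
      ‖((ContinuousLinearEquiv.refl ℝ E).symm : E →L[ℝ] E)‖₊⁻¹ := by
    rcases subsingleton_or_nontrivial E with h | h
    · exact Or.inl h
    · right
      have : ‖((ContinuousLinearEquiv.refl ℝ E).symm : E →L[ℝ] E)‖₊ = 1 :=
        NNReal.eq ContinuousLinearMap.norm_id
      rw [this, inv_one]
      exact Real.toNNReal_lt_one.2 hε1
  let e := happ.toOpenPartialHomeomorph G U hc hU
  have hleft : ∀ x ∈ U, e.symm (G x) = x := fun x hx => e.left_inv hx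
  refine ⟨happ.injOn hc, e.open_target, e.symm, ?_, hleft, fun y hy => e.right_inv hy⟩
  rintro _ ⟨x, hx, rfl⟩
  have hu : IsUnit (fderiv ℝ G x) := by
    have := isUnit_one_sub_of_norm_lt_one ((hε x hx).trans_lt hε1)
    rwa [ContinuousLinearMap.one_def, sub_sub_cancel] at this
  obtain ⟨u, hu⟩ := hu
  refine (e.contDiffAt_symm (f₀' := ContinuousLinearEquiv.ofUnit u)
    (mem_image_of_mem G hx) ?_ ?_).contDiffWithinAt
  · rw [hleft x hx]
    have : ((ContinuousLinearEquiv.ofUnit u : E ≃L[ℝ] E) : E →L[ℝ] E) = fderiv ℝ G x := hu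
    rw [this]
    exact ((hG.differentiableOn hk' x hx).differentiableAt (hU.mem_nhds hx)).hasFDerivAt
  · rw [hleft x hx]
    exact hG.contDiffAt (hU.mem_nhds hx)

/-- One step of the recursion bounding the derivatives of an inverse: differentiate
`H' = 1 + (1 - G' ∘ H) H'` and absorb the term containing the top derivative of `H'`. -/
theorem norm_iteratedFDerivWithin_succ_inverse_le {U V : Set E} {G H : E → E} {ε M K : ℝ}
    {n : ℕ} (hU : IsOpen U) (hV : IsOpen V) (hG : ContDiffOn ℝ (n + 1) G U)
    (hH : ContDiffOn ℝ (n + 1) H V) (hHV : MapsTo H V U) (hGH : ∀ y ∈ V, G (H y) = y)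
    (hε1 : ε < 1) (hε : ∀ x ∈ U, ‖ContinuousLinearMap.id ℝ E - fderivWithin ℝ G U x‖ ≤ ε)
    (hM : 1 ≤ M)
    (hK : ∀ i ≤ n, ∀ x ∈ U, ‖iteratedFDerivWithin ℝ i
      (fun x => ContinuousLinearMap.id ℝ E - fderivWithin ℝ G U x) U x‖ ≤ K)
    (hHM : ∀ i, 1 ≤ i → i ≤ n → ∀ y ∈ V, ‖iteratedFDerivWithin ℝ i H V y‖ ≤ M)
    {y : E} (hy : y ∈ V) :
    ‖iteratedFDerivWithin ℝ (n + 1) H V y‖ ≤ (1 + 2 ^ n * (n ! * K * M ^ n * M)) / (1 - ε) := by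
  have hK0 : 0 ≤ K := (norm_nonneg _).trans (hK 0 (Nat.zero_le _) _ (hHV hy))
  have hUd := hU.uniqueDiffOn (𝕜 := ℝ)
  have hVd := hV.uniqueDiffOn (𝕜 := ℝ)
  set Q : E → E →L[ℝ] E := fun x => ContinuousLinearMap.id ℝ E - fderivWithin ℝ G U x with hQ
  set A : E → E →L[ℝ] E := fderivWithin ℝ H V with hA
  have hQc : ContDiffOn ℝ n Q U := contDiffOn_const.sub (hG.fderivWithin hUd le_rfl)
  have hAc : ContDiffOn ℝ n A V := hH.fderivWithin hVd le_rfl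
  have hHc : ContDiffOn ℝ n H V := hH.of_le (by exact_mod_cast Nat.le_succ n)
  have hPc : ContDiffOn ℝ n (Q ∘ H) V := hQc.comp hHc hHV
  have hne : ((n : ℕ∞ω) + 1) ≠ 0 := by positivity
  have key : ∀ z ∈ V, A z = ContinuousLinearMap.id ℝ E +
      ContinuousLinearMap.compL ℝ E E E ((Q ∘ H) z) (A z) := by
    intro z hz
    have h1 : HasFDerivWithinAt (G ∘ H) ((fderivWithin ℝ G U (H z)).comp (A z)) V z :=
      ((hG.differentiableOn hne _ (hHV hz)).hasFDerivWithinAt).comp z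
        ((hH.differentiableOn hne z hz).hasFDerivWithinAt) hHV
    have h2 : HasFDerivWithinAt (G ∘ H) (ContinuousLinearMap.id ℝ E) V z :=
      (hasFDerivWithinAt_id z V).congr hGH (hGH z hz)
    have h3 := (hVd z hz).eq h1 h2
    ext v
    have := DFunLike.congr_fun h3 v
    simp only [ContinuousLinearMap.comp_apply, ContinuousLinearMap.id_apply] at this
    simp [hQ, this]
  have hcomp : ContDiffOn ℝ n
      (fun z => ContinuousLinearMap.compL ℝ E E E ((Q ∘ H) z) (A z)) V :=
    hPc.clm_comp hAc
  rw [← norm_iteratedFDerivWithin_fderivWithin hVd hy]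
  have hid : ‖iteratedFDerivWithin ℝ n (fun _ : E => ContinuousLinearMap.id ℝ E) V y‖ ≤ 1 := by
    rcases Nat.eq_zero_or_pos n with rfl | hn
    · simpa using ContinuousLinearMap.norm_id_le
    · rw [iteratedFDerivWithin_const_of_ne hn.ne']
      simp
  have hbil := (ContinuousLinearMap.compL ℝ E E E).norm_iteratedFDerivWithin_le_of_bilinear_of_le_one
    hPc hAc hVd hy le_rfl (ContinuousLinearMap.norm_compL_le ℝ E E E)
  have hsplit : iteratedFDerivWithin ℝ n A V y =
      iteratedFDerivWithin ℝ n (fun _ : E => ContinuousLinearMap.id ℝ E) V y +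
      iteratedFDerivWithin ℝ n
        (fun z => ContinuousLinearMap.compL ℝ E E E ((Q ∘ H) z) (A z)) V y := by
    rw [iteratedFDerivWithin_congr key hy]
    exact fun_iteratedFDerivWithin_add_apply contDiffWithinAt_const (hcomp y hy) hVd hy
  have hP : ∀ i ≤ n, ‖iteratedFDerivWithin ℝ i (Q ∘ H) V y‖ ≤ n ! * K * M ^ n := by
    intro i hi
    have := norm_iteratedFDerivWithin_comp_le hQc hHc (Nat.cast_le.2 hi) hUd hVd hHV hy
      (fun j hj => hK j (hj.trans hi) _ (hHV hy)) (D := M)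
      (fun j hj1 hj => (hHM j hj1 (hj.trans hi) y hy).trans
        (le_self_pow₀ hM (by omega)))
    refine this.trans ?_
    gcongr
  have hsum : ∑ i ∈ Finset.range (n + 1), (n.choose i : ℝ) *
        ‖iteratedFDerivWithin ℝ i (Q ∘ H) V y‖ * ‖iteratedFDerivWithin ℝ (n - i) A V y‖ ≤
      2 ^ n * (n ! * K * M ^ n * M) + ε * ‖iteratedFDerivWithin ℝ n A V y‖ := by
    rw [Finset.sum_range_succ']
    have hR : 0 ≤ n ! * K * M ^ n * M := by positivity
    refine add_le_add ?_ ?_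
    · calc
        _ ≤ ∑ i ∈ Finset.range n, (n.choose (i + 1) : ℝ) * (n ! * K * M ^ n * M) := by
          refine Finset.sum_le_sum fun i hi => ?_
          have hi := Finset.mem_range.1 hi
          rw [mul_assoc]
          refine mul_le_mul_of_nonneg_left ?_ (Nat.cast_nonneg _)
          refine mul_le_mul (hP _ (by omega)) ?_ (norm_nonneg _) (by positivity)
          rw [hA, norm_iteratedFDerivWithin_fderivWithin hVd hy]
          exact hHM _ (by omega) (by omega) y hy
        _ ≤ 2 ^ n * (n ! * K * M ^ n * M) := by
          rw [← Finset.sum_mul]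
          refine mul_le_mul_of_nonneg_right ?_ hR
          have := Nat.sum_range_choose n
          rw [Finset.sum_range_succ'] at this
          have h' : ∑ i ∈ Finset.range n, n.choose (i + 1) ≤ 2 ^ n := by omega
          exact_mod_cast h'
    · simp only [Nat.choose_zero_right, Nat.cast_one, one_mul, norm_iteratedFDerivWithin_zero,
        Nat.sub_zero]
      exact mul_le_mul_of_nonneg_right (hε _ (hHV hy)) (norm_nonneg _)
  rw [le_div_iff₀ (by linarith)]
  have : ‖iteratedFDerivWithin ℝ n A V y‖ ≤ _ := hsplit ▸ norm_add_le _ _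
  linarith

end InverseBounds

/-- The derivatives up to order `n ≤ k` of an inverse are bounded in terms of `n`, `ε` and bounds on
the derivatives of the original map, uniformly in the map and in the space. -/
theorem exists_forall_norm_iteratedFDerivWithin_inverse_le {ε : ℝ} (hε1 : ε < 1) (L : ℕ → ℝ)
    (n : ℕ) :
    ∃ M : ℝ, 1 ≤ M ∧ ∀ (E : Type) [NormedAddCommGroup E] [NormedSpace ℝ E]
      (U V : Set E) (G H : E → E), IsOpen U → IsOpen V → ContDiffOn ℝ n G U → ContDiffOn ℝ n H V →
      MapsTo H V U → (∀ y ∈ V, G (H y) = y) →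
      (∀ x ∈ U, ‖ContinuousLinearMap.id ℝ E - fderivWithin ℝ G U x‖ ≤ ε) →
      (∀ j, 2 ≤ j → j ≤ n → ∀ x ∈ U, ‖iteratedFDerivWithin ℝ j G U x‖ ≤ L j) →
      ∀ i, 1 ≤ i → i ≤ n → ∀ y ∈ V, ‖iteratedFDerivWithin ℝ i H V y‖ ≤ M := by
  induction n with
  | zero => exact ⟨1, le_rfl, fun _ _ _ _ _ _ _ _ _ _ _ _ _ _ _ _ _ _ => by omega⟩
  | succ n ih =>
    obtain ⟨M, hM, h⟩ := ih
    set K : ℝ := 1 + ∑ j ∈ Finset.range (n + 2), |L j| with hKdef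
    refine ⟨max M ((1 + 2 ^ n * (n ! * K * M ^ n * M)) / (1 - ε)), hM.trans (le_max_left _ _), ?_⟩
    intro E _ _ U V G H hU hV hG hH hHV hGH hε hL i hi1 hi y hy
    have hUd := hU.uniqueDiffOn (𝕜 := ℝ)
    have hnn : (n : ℕ∞ω) ≤ (n + 1 : ℕ) := by exact_mod_cast Nat.le_succ n
    have hHM := h E U V G H hU hV (hG.of_le hnn) (hH.of_le hnn) hHV hGH hε
      (fun j hj2 hj => hL j hj2 (hj.trans n.le_succ))
    rcases hi.lt_or_eq with hlt | rfl
    · exact (hHM i hi1 (by omega) y hy).trans (le_max_left _ _)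
    refine le_trans ?_ (le_max_right _ _)
    refine norm_iteratedFDerivWithin_succ_inverse_le hU hV (by exact_mod_cast hG)
      (by exact_mod_cast hH) hHV hGH hε1 hε hM ?_ hHM hy
    intro j hj x hx
    rcases Nat.eq_zero_or_pos j with rfl | hj0
    · rw [norm_iteratedFDerivWithin_zero]
      have : 0 ≤ ∑ j ∈ Finset.range (n + 2), |L j| := Finset.sum_nonneg fun _ _ => abs_nonneg _
      linarith [hε x hx]
    · have hG' : ContDiffOn ℝ n (fderivWithin ℝ G U) U :=
        hG.fderivWithin hUd (by exact_mod_cast le_rfl)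
      have hjn : (j : ℕ∞ω) ≤ n := Nat.cast_le.2 hj
      have hsub : iteratedFDerivWithin ℝ j
          (fun x => ContinuousLinearMap.id ℝ E - fderivWithin ℝ G U x) U x =
          - iteratedFDerivWithin ℝ j (fderivWithin ℝ G U) U x := by
        rw [fun_iteratedFDerivWithin_sub_apply contDiffWithinAt_const
          ((hG'.of_le hjn) x hx) hUd hx, iteratedFDerivWithin_const_of_ne hj0.ne']
        simp
      rw [hsub, norm_neg, norm_iteratedFDerivWithin_fderivWithin hUd hx]
      have h1 := hL (j + 1) (by omega) (by omega) x hx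
      have h2 := Finset.single_le_sum (f := fun j => |L j|) (fun _ _ => abs_nonneg _)
        (Finset.mem_range.2 (show j + 1 < n + 2 by omega))
      have h3 := le_abs_self (L (j + 1))
      linarith


/-- If `G : U → ℝ^d` is `C^k` (`k ≥ 2`) on an open convex set `U` with
`‖I_d − d_x G‖_op ≤ ε < 1` and `‖d^j_x G‖_op ≤ L_j` for `2 ≤ j ≤ k` on `U`, then `G` is a
`C^k`-diffeomorphism onto its image and, for each `2 ≤ i ≤ k`, the `i`-th differential of the
inverse is bounded by a finite constant `C` depending only on `i`, `ε` and the `L_j`'s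
(in particular, not on `d`, `U` or `G`). -/
theorem inverse_quantitative_higher_order
    (k : ℕ) (hk : 2 ≤ k)
    (ε : ℝ) (hε : ε < 1)
    (L : ℕ → ℝ) (hL : ∀ j, 2 ≤ j → j ≤ k → 0 < L j) :
    ∀ i, 2 ≤ i → i ≤ k →
      ∃ C : ℝ,
        ∀ (d : ℕ) (U : Set (EuclideanSpace ℝ (Fin d)))
          (G : EuclideanSpace ℝ (Fin d) → EuclideanSpace ℝ (Fin d)),
          IsOpen U → Convex ℝ U → ContDiffOn ℝ k G U →
          (∀ x ∈ U,
            ‖ContinuousLinearMap.id ℝ (EuclideanSpace ℝ (Fin d)) - fderiv ℝ G x‖ ≤ ε) →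
          (∀ j, 2 ≤ j → j ≤ k → ∀ x ∈ U, ‖iteratedFDeriv ℝ j G x‖ ≤ L j) →
          Set.InjOn G U ∧ IsOpen (G '' U) ∧
            ∃ H : EuclideanSpace ℝ (Fin d) → EuclideanSpace ℝ (Fin d),
              ContDiffOn ℝ k H (G '' U) ∧
              (∀ x ∈ U, H (G x) = x) ∧ (∀ y ∈ G '' U, G (H y) = y) ∧
              ∀ y ∈ G '' U, ‖iteratedFDeriv ℝ i H y‖ ≤ C := by
  intro i hi2 hik
  obtain ⟨M, -, hM⟩ := exists_forall_norm_iteratedFDerivWithin_inverse_le hε L i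
  refine ⟨M, fun d U G hU hconv hG hGε hGL => ?_⟩
  obtain ⟨hinj, hopen, H, hH, hHG, hGH⟩ :=
    exists_contDiffOn_inverse_of_norm_id_sub_fderiv_le (by omega) hε hU hconv hG hGε
  refine ⟨hinj, hopen, H, hH, hHG, hGH, fun y hy => ?_⟩
  have hik' : (i : ℕ∞ω) ≤ k := Nat.cast_le.2 hik
  rw [← iteratedFDerivWithin_of_isOpen i hopen hy]
  refine hM _ U (G '' U) G H hU hopen (hG.of_le hik') (hH.of_le hik') ?_ hGH ?_ ?_ i
    (by omega) le_rfl y hy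
  · rintro _ ⟨x, hx, rfl⟩
    rwa [hHG x hx]
  · intro x hx
    rw [fderivWithin_of_isOpen hU hx]
    exact hGε x hx
  · intro j hj2 hj x hx
    rw [iteratedFDerivWithin_of_isOpen j hU hx]
    exact hGL j hj2 (hj.trans hik) x hx
end

section
/- (Tensorization of the L¹ test affinity.) Let P and Q be probability measures on a measurable space (E, ℰ) and let n ≥ 1 be an integer. Then ‖P^{⊗n} ∧ Q^{⊗n}‖₁ ≥ ( ‖P ∧ Q‖₁ )^n. -/
open MeasureTheory
open scoped ENNReal

/-- The `L¹` test affinity `‖P ∧ Q‖₁` of two measures, computed with respect to the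
dominating measure `P + Q`. -/
noncomputable def affinity {E : Type*} [MeasurableSpace E] (P Q : Measure E) : ℝ≥0∞ :=
  ∫⁻ x, min (P.rnDeriv (P + Q) x) (Q.rnDeriv (P + Q) x) ∂(P + Q)

/-- The product of a finite family of measures is monotone in every factor. -/
theorem MeasureTheory.Measure.pi_le_pi {ι : Type*} [Fintype ι] {α : ι → Type*}
    [∀ i, MeasurableSpace (α i)] {μ ν : ∀ i, Measure (α i)} (h : ∀ i, μ i ≤ ν i) :
    Measure.pi μ ≤ Measure.pi ν := by
  refine Measure.le_iff.2 fun s hs => ?_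
  rw [Measure.pi, Measure.pi, toMeasure_apply _ _ hs, toMeasure_apply _ _ hs]
  have hle : OuterMeasure.pi (fun i => (μ i).toOuterMeasure) ≤
      OuterMeasure.pi fun i => (ν i).toOuterMeasure :=
    OuterMeasure.le_pi.2 fun t _ => (OuterMeasure.pi_pi_le _ t).trans
      (Finset.prod_le_prod' fun i _ => h i (t i))
  exact hle s

/-- The common lower bound of `P` and `Q` whose total mass is the affinity. -/
noncomputable def affinityMeasure {E : Type*} [MeasurableSpace E] (P Q : Measure E) : Measure E :=
  (P + Q).withDensity fun x => min (P.rnDeriv (P + Q) x) (Q.rnDeriv (P + Q) x)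

theorem affinityMeasure_univ {E : Type*} [MeasurableSpace E] (P Q : Measure E) :
    affinityMeasure P Q Set.univ = affinity P Q := by
  rw [affinityMeasure, withDensity_apply _ MeasurableSet.univ, Measure.restrict_univ, affinity]

theorem affinityMeasure_le_left {E : Type*} [MeasurableSpace E] (P Q : Measure E) :
    affinityMeasure P Q ≤ P :=
  (withDensity_mono (ae_of_all _ fun _ => min_le_left _ _)).trans
    (Measure.withDensity_rnDeriv_le P (P + Q))

theorem affinityMeasure_le_right {E : Type*} [MeasurableSpace E] (P Q : Measure E) :
    affinityMeasure P Q ≤ Q :=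
  (withDensity_mono (ae_of_all _ fun _ => min_le_right _ _)).trans
    (Measure.withDensity_rnDeriv_le Q (P + Q))

theorem rnDeriv_le_rnDeriv_of_le {E : Type*} [MeasurableSpace E] {M P R : Measure E}
    [IsFiniteMeasure P] [SigmaFinite R] (h : M ≤ P) (hP : P ≪ R) :
    M.rnDeriv R ≤ᵐ[R] P.rnDeriv R := by
  have : IsFiniteMeasure M := isFiniteMeasure_of_le P h
  refine ae_le_of_forall_setLIntegral_le_of_sigmaFinite (Measure.measurable_rnDeriv _ _)
    fun s _ _ => ?_
  rw [Measure.setLIntegral_rnDeriv (h.absolutelyContinuous.trans hP),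
    Measure.setLIntegral_rnDeriv hP]
  exact h s

/-- The affinity dominates the mass of every common lower bound. -/
theorem measure_univ_le_affinity {E : Type*} [MeasurableSpace E] {M P Q : Measure E}
    [IsFiniteMeasure P] [IsFiniteMeasure Q] (hP : M ≤ P) (hQ : M ≤ Q) :
    M Set.univ ≤ affinity P Q := by
  have : IsFiniteMeasure M := isFiniteMeasure_of_le P hP
  have hPac : P ≪ P + Q := (Measure.le_add_right le_rfl).absolutelyContinuous
  have hQac : Q ≪ P + Q := (Measure.le_add_left le_rfl).absolutelyContinuous
  rw [← Measure.lintegral_rnDeriv (hP.absolutelyContinuous.trans hPac), affinity]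
  refine lintegral_mono_ae ?_
  filter_upwards [rnDeriv_le_rnDeriv_of_le hP hPac, rnDeriv_le_rnDeriv_of_le hQ hQac]
    with x hx hx' using le_min hx hx'

/-- **Tensorization of the L¹ test affinity**: `‖P^{⊗n} ∧ Q^{⊗n}‖₁ ≥ (‖P ∧ Q‖₁)^n`. -/
theorem affinity_pi_ge_pow
    {E : Type*} [MeasurableSpace E]
    (P Q : Measure E) [IsProbabilityMeasure P] [IsProbabilityMeasure Q]
    (n : ℕ) (hn : 1 ≤ n) :
    (affinity P Q) ^ n ≤
      affinity (Measure.pi fun _ : Fin n => P) (Measure.pi fun _ : Fin n => Q) := by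
  have : IsFiniteMeasure (affinityMeasure P Q) :=
    isFiniteMeasure_of_le P (affinityMeasure_le_left P Q)
  have h := measure_univ_le_affinity
    (Measure.pi_le_pi fun _ : Fin n => affinityMeasure_le_left P Q)
    (Measure.pi_le_pi fun _ : Fin n => affinityMeasure_le_right P Q)
  simpa [Measure.pi_univ, affinityMeasure_univ] using h
end
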